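/- Let v be a nonzero vector in ℝ² and let G be a subgroup of the group of 2×2 integer matrices with determinant ±1 (i.e. GL₂(ℤ)) such that for every g ∈ G there exists a real number χ(g) > 0 with g·v = χ(g)·v (the matrix g acting on ℝ²). Then the map g ↦ χ(g) is a group homomorphism from G to the multiplicative group of positive real numbers, and its image is either trivial or infinite cyclic; that is, there exists a real number c ≥ 1 such that χ(G) = {cⁿ : n ∈ ℤ}. -/

import Mathlib

/-- A positive real root of `x² - t x + d` with `t` an integer and `d = ±1` cannot lie strictly
between `1` and `3 / 2`. -/
lemma three_halves_le_of_quadratic_unit {x : ℝ} {t d : ℤ} (hd : d = 1 ∨ d = -1)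
    (hx : x ^ 2 - t * x + d = 0) (h1 : 1 < x) : 3 / 2 ≤ x := by
  by_contra! h2
  rcases hd with rfl | rfl
  · push_cast at hx
    have ht : (2 : ℝ) < t := by nlinarith [sq_pos_of_pos (sub_pos.2 h1)]
    have ht' : (t : ℝ) < 3 := by nlinarith
    have : 2 < t := by exact_mod_cast ht
    have : t < 3 := by exact_mod_cast ht'
    lia
  · push_cast at hx
    have ht : (0 : ℝ) < t := by nlinarith
    have ht' : (t : ℝ) < 1 := by nlinarith
    have : 0 < t := by exact_mod_cast ht
    have : t < 1 := by exact_mod_cast ht'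
    lia

/-- A real eigenvalue of a `2 × 2` integer matrix is a root of its characteristic polynomial. -/
lemma sq_sub_trace_mul_add_det_eq_zero (M : Matrix (Fin 2) (Fin 2) ℤ) {v : Fin 2 → ℝ}
    (hv : v ≠ 0) {x : ℝ} (h : (M.map (fun n => (n : ℝ))).mulVec v = x • v) :
    x ^ 2 - (M.trace : ℤ) * x + (M.det : ℤ) = 0 := by
  have h0 := congrFun h 0
  have h1 := congrFun h 1
  simp only [Matrix.mulVec, dotProduct, Fin.sum_univ_two, Matrix.map_apply, Pi.smul_apply,
    smul_eq_mul] at h0 h1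
  rw [Matrix.trace_fin_two, Matrix.det_fin_two]
  push_cast
  obtain ⟨i, hi⟩ := Function.ne_iff.1 hv
  refine (mul_eq_zero.1 ?_).resolve_right hi
  fin_cases i
  · simp only [Fin.zero_eta]
    linear_combination (M 1 1 - x : ℝ) * h0 - (M 0 1 : ℝ) * h1
  · simp only [Fin.mk_one]
    linear_combination (M 0 0 - x : ℝ) * h1 - (M 1 0 : ℝ) * h0

/-- A homomorphism to the positive reals with no value strictly between `1` and some `a > 1` has
image the set of integral powers of a real number `c ≥ 1`. -/
lemma exists_range_eq_zpow {G : Type*} [Group G] (χ : G → ℝ) (hpos : ∀ g, 0 < χ g)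
    (hmul : ∀ g h, χ (g * h) = χ g * χ h) {a : ℝ} (ha : 1 < a)
    (hgap : ∀ g, 1 < χ g → a ≤ χ g) :
    ∃ c : ℝ, 1 ≤ c ∧ Set.range χ = {x : ℝ | ∃ n : ℤ, x = c ^ n} := by
  have hone : χ 1 = 1 := by
    have h := hmul 1 1
    rw [mul_one] at h
    exact (mul_eq_left₀ (hpos 1).ne').1 h.symm
  have hinv (g : G) : χ g⁻¹ = (χ g)⁻¹ := by
    apply eq_inv_of_mul_eq_one_left
    rw [← hmul, inv_mul_cancel, hone]
  let S : AddSubgroup ℝ :=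
    { carrier := {x | ∃ g, χ g = Real.exp x}
      zero_mem' := ⟨1, by rw [hone, Real.exp_zero]⟩
      add_mem' := by
        rintro x y ⟨g, hg⟩ ⟨h, hh⟩
        exact ⟨g * h, by rw [hmul, hg, hh, Real.exp_add]⟩
      neg_mem' := by
        rintro x ⟨g, hg⟩
        exact ⟨g⁻¹, by rw [hinv, hg, Real.exp_neg]⟩ }
  have hS (x : ℝ) : x ∈ S ↔ ∃ g, χ g = Real.exp x := Iff.rfl
  obtain ⟨b, hb⟩ : ∃ b, S = AddSubgroup.closure {b} := by
    refine AddSubgroup.cyclic_of_isolated_zero (Real.log_pos ha) (Set.disjoint_left.2 ?_)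
    rintro x ⟨g, hg⟩ ⟨hx0, hxa⟩
    have h := hgap g (hg ▸ Real.one_lt_exp_iff.2 hx0)
    rw [hg] at h
    exact hxa.not_ge ((Real.log_le_iff_le_exp (by positivity)).2 h)
  have hb' : S = AddSubgroup.closure {|b|} := by
    rcases abs_choice b with h | h <;> rw [h, hb]
    rw [← Set.neg_singleton, AddSubgroup.closure_neg]
  refine ⟨Real.exp |b|, Real.one_le_exp (abs_nonneg b), Set.ext fun x => ?_⟩
  have key (n : ℤ) : Real.exp |b| ^ n = Real.exp (n • |b|) := by
    rw [zsmul_eq_mul, mul_comm, Real.exp_mul, Real.rpow_intCast]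
  simp only [Set.mem_range, Set.mem_ofPred_eq, key]
  constructor
  · rintro ⟨g, rfl⟩
    have hmem : Real.log (χ g) ∈ S := (hS _).2 ⟨g, (Real.exp_log (hpos g)).symm⟩
    rw [hb', AddSubgroup.mem_closure_singleton] at hmem
    obtain ⟨n, hn⟩ := hmem
    exact ⟨n, by rw [hn, Real.exp_log (hpos g)]⟩
  · rintro ⟨n, rfl⟩
    rw [← hS, hb', AddSubgroup.mem_closure_singleton]
    exact ⟨n, rfl⟩


/-- Let `v ≠ 0` in `ℝ²` and let `G` be a subgroup of `GL₂(ℤ)` such that every `g ∈ G`, acting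
on `ℝ²`, has `v` as an eigenvector with a positive eigenvalue `χ g`. Then `χ` is a group
homomorphism into the positive reals, and its image is either trivial or infinite cyclic:
there is a real `c ≥ 1` with `χ(G) = {cⁿ : n ∈ ℤ}`. -/
theorem eigenvalue_character_image_cyclic
    (v : Fin 2 → ℝ) (hv : v ≠ 0)
    (G : Subgroup (Matrix.GeneralLinearGroup (Fin 2) ℤ))
    (χ : G → ℝ)
    (hχpos : ∀ g : G, 0 < χ g)
    (hχ : ∀ g : G,
      (((g : Matrix.GeneralLinearGroup (Fin 2) ℤ) : Matrix (Fin 2) (Fin 2) ℤ).map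
          (fun n => (n : ℝ))).mulVec v = χ g • v) :
    (∀ g h : G, χ (g * h) = χ g * χ h) ∧
    ∃ c : ℝ, 1 ≤ c ∧ Set.range χ = {x : ℝ | ∃ n : ℤ, x = c ^ n} := by
  have hmul (g h : G) : χ (g * h) = χ g * χ h := by
    apply smul_left_injective ℝ hv
    have hmap : (((g * h : G) : Matrix.GeneralLinearGroup (Fin 2) ℤ) :
        Matrix (Fin 2) (Fin 2) ℤ).map (fun n => (n : ℝ)) =
        ((g : Matrix.GeneralLinearGroup (Fin 2) ℤ) : Matrix (Fin 2) (Fin 2) ℤ).map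
          (fun n => (n : ℝ)) *
        ((h : Matrix.GeneralLinearGroup (Fin 2) ℤ) : Matrix (Fin 2) (Fin 2) ℤ).map
          (fun n => (n : ℝ)) :=
      Matrix.map_mul (f := Int.castRingHom ℝ)
    change χ (g * h) • v = (χ g * χ h) • v
    rw [← hχ, hmap, ← Matrix.mulVec_mulVec, hχ h, Matrix.mulVec_smul, hχ g, smul_smul, mul_comm]
  refine ⟨hmul, exists_range_eq_zpow χ hχpos hmul (a := 3 / 2) (by norm_num) fun g hg => ?_⟩
  exact three_halves_le_of_quadratic_unit
    (Int.isUnit_iff.1 ((Matrix.isUnit_iff_isUnit_det _).1 g.1.isUnit))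
    (sq_sub_trace_mul_add_det_eq_zero _ hv (hχ g)) hg
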